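/- arXiv:2104.09451 — 3 statements merged into one kernel-verified Lean document; each statement's English description precedes it below -/
import Mathlib

section
/- Let G be a finite connected simple graph, v a vertex of G, and A a set of vertices of G such that the Explorer has a strategy for the game started at v guaranteeing, against every Director strategy, that some token position of the play lies in A. Then f_d(G,v) ≥ min_{a ∈ A} ecc(a) + 1. -/
open SimpleGraph

variable {V : Type*}

/-- The eccentricity of a vertex: the maximum graph distance to any vertex. -/
noncomputable def ecc [Fintype V] (G : SimpleGraph V) (u : V) : ℕ :=
  Finset.univ.sup fun w => G.dist u w

/-- The diameter of a graph: the maximum eccentricity. -/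
noncomputable def graphDiam [Fintype V] (G : SimpleGraph V) : ℕ :=
  Finset.univ.sup fun u => ecc G u

/-- A nonempty set `U` of vertices is closed if for every `u ∈ U` and every vertex `v`
there is `x ∈ U` with `dist u v = dist u x`. -/
def IsClosedSet (G : SimpleGraph V) (U : Set V) : Prop :=
  U.Nonempty ∧ ∀ u ∈ U, ∀ v : V, ∃ x ∈ U, G.dist u v = G.dist u x

/-- An Explorer strategy (assigning a called distance to each history, most recent
vertex first) is valid if, whenever the current vertex `u` has a legal call available
(`1 ≤ ecc u`), it calls some `k` with `1 ≤ k ≤ ecc u`. -/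
def EValid [Fintype V] (G : SimpleGraph V) (ES : List V → ℕ) : Prop :=
  ∀ h : List V, ∀ u : V, h.head? = some u → 1 ≤ ecc G u →
    1 ≤ ES h ∧ ES h ≤ ecc G u

/-- A Director strategy is valid if, for each history with current vertex `u` and each
legal called distance `k` (`1 ≤ k ≤ ecc u`), it answers a vertex at distance exactly `k`. -/
def DValid [Fintype V] (G : SimpleGraph V) (DS : List V → ℕ → V) : Prop :=
  ∀ h : List V, ∀ u : V, h.head? = some u → ∀ k : ℕ, 1 ≤ k → k ≤ ecc G u →
    G.dist u (DS h k) = k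

/-- The history (most recent vertex first) of the first `n` moves of the play determined
by Explorer strategy `ES` and Director strategy `DS`, starting at `v`. -/
def play (ES : List V → ℕ) (DS : List V → ℕ → V) (v : V) : ℕ → List V
  | 0 => [v]
  | n + 1 => DS (play ES DS v n) (ES (play ES DS v n)) :: play ES DS v n

/-- The number of distinct vertices visited in the play determined by `ES` and `DS`
starting at `v`. -/
noncomputable def playScore (ES : List V → ℕ) (DS : List V → ℕ → V) (v : V) : ℕ :=
  Set.ncard {x : V | ∃ n : ℕ, x ∈ play ES DS v n}

/-- `fd G v` : the max over valid Explorer strategies of the min over valid Director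
strategies of the number of distinct vertices visited. -/
noncomputable def fd [Fintype V] (G : SimpleGraph V) (v : V) : ℕ :=
  sSup {r : ℕ | ∃ ES : List V → ℕ, EValid G ES ∧
    r = sInf {s : ℕ | ∃ DS : List V → ℕ → V, DValid G DS ∧ s = playScore ES DS v}}

/-- A play `x` is consistent with the nonadaptive strategy `S` from start `v` if it starts
at `v` and each step has the prescribed length. -/
def NAConsistent (G : SimpleGraph V) (S : List ℕ) (v : V) (x : ℕ → V) : Prop :=
  x 0 = v ∧ ∀ i < S.length, G.dist (x i) (x (i + 1)) = S.getD i 0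

/-- A nonadaptive strategy is playable from `v` if every consistent initial segment
can be extended. -/
def NAPlayable (G : SimpleGraph V) (S : List ℕ) (v : V) : Prop :=
  ∀ x : ℕ → V, ∀ i < S.length, x 0 = v →
    (∀ j < i, G.dist (x j) (x (j + 1)) = S.getD j 0) →
    ∃ y : V, G.dist (x i) y = S.getD i 0

/-- The score of a nonadaptive strategy `S` from `v`: the minimum over consistent plays
of the number of distinct vertices among `x 0, …, x S.length`. -/
noncomputable def naScore (G : SimpleGraph V) (S : List ℕ) (v : V) : ℕ :=
  sInf {k : ℕ | ∃ x : ℕ → V, NAConsistent G S v x ∧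
    k = Set.ncard {w : V | ∃ i ≤ S.length, x i = w}}

/-- The `n × m` grid graph: the box product of two path graphs. -/
def gridGraph (n m : ℕ) : SimpleGraph (Fin n × Fin m) :=
  (pathGraph n) □ (pathGraph m)

section Forcing

lemma exists_head?_play (ES : List V → ℕ) (DS : List V → ℕ → V) (v : V) (n : ℕ) :
    ∃ u, (play ES DS v n).head? = some u := by
  cases n <;> exact ⟨_, rfl⟩

lemma exists_head?_eq_of_mem_play {ES : List V → ℕ} {DS : List V → ℕ → V} {v x : V} {n : ℕ}
    (hx : x ∈ play ES DS v n) : ∃ n', (play ES DS v n').head? = some x := by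
  induction n with
  | zero => exact ⟨0, by simp_all [play]⟩
  | succ n ih =>
    rw [play, List.mem_cons] at hx
    rcases hx with rfl | hx
    · exact ⟨n + 1, rfl⟩
    · exact ih hx

variable [Fintype V] {G : SimpleGraph V}

lemma dist_le_ecc (u w : V) : G.dist u w ≤ ecc G u :=
  Finset.le_sup (f := fun w => G.dist u w) (Finset.mem_univ w)

lemma exists_dist_eq_ecc [Nonempty V] (u : V) : ∃ w, G.dist u w = ecc G u := by
  obtain ⟨w, -, hw⟩ := Finset.exists_mem_eq_sup Finset.univ Finset.univ_nonempty
    fun w => G.dist u w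
  exact ⟨w, hw.symm⟩

lemma ecc_le_dist_add_ecc (hG : G.Connected) (x y : V) :
    ecc G x ≤ G.dist x y + ecc G y :=
  Finset.sup_le fun w _ => hG.dist_triangle.trans (Nat.add_le_add_left (dist_le_ecc y w) _)

lemma exists_dist_eq_of_le_ecc (hG : G.Connected) (u : V) {k : ℕ} (hk : k ≤ ecc G u) :
    ∃ y, G.dist u y = k := by
  have := hG.nonempty
  obtain ⟨w, hw⟩ := exists_dist_eq_ecc (G := G) u
  obtain ⟨p, hp⟩ := (hG u w).exists_walk_length_eq_dist
  refine ⟨p.getVert k, le_antisymm ?_ ?_⟩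
  · exact (dist_le (p.take k)).trans (by simp [Walk.take_length])
  · have h₁ := dist_le (p.drop k)
    rw [Walk.drop_length] at h₁
    have h₂ := hG.dist_triangle (u := u) (v := p.getVert k) (w := w)
    omega

/-- Every valid Explorer strategy can be met by a valid Director strategy. -/
lemma exists_dValid (hG : G.Connected) : ∃ DS : List V → ℕ → V, DValid G DS := by
  have := hG.nonempty
  have h : ∀ (h : List V) (k : ℕ), ∃ y : V, ∀ u, h.head? = some u → k ≤ ecc G u →
      G.dist u y = k := by
    intro h k
    by_cases hu : ∃ u, h.head? = some u ∧ k ≤ ecc G u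
    · obtain ⟨u, hu, hk⟩ := hu
      obtain ⟨y, hy⟩ := exists_dist_eq_of_le_ecc hG u hk
      refine ⟨y, fun u' hu' _ => ?_⟩
      rw [hu, Option.some.injEq] at hu'
      rwa [← hu']
    · push Not at hu
      exact ⟨Classical.arbitrary V, fun u h₁ h₂ => absurd h₂ (by simpa using hu u h₁)⟩
  choose DS hDS using h
  exact ⟨DS, fun h u hu k _ hk => hDS h k u hu hk⟩

lemma card_le_playScore [DecidableEq V] (ES : List V → ℕ) (DS : List V → ℕ → V) (v : V)
    (n : ℕ) : (play ES DS v n).toFinset.card ≤ playScore ES DS v := by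
  rw [← Set.ncard_coe_finset]
  exact Set.ncard_le_ncard (t := {x | ∃ n, x ∈ play ES DS v n})
    (fun x hx => ⟨n, by simpa using hx⟩) (Set.toFinite _)

lemma le_fd (hG : G.Connected) {v : V} {m : ℕ} (ES : List V → ℕ) (hES : EValid G ES)
    (h : ∀ DS : List V → ℕ → V, DValid G DS → m ≤ playScore ES DS v) : m ≤ fd G v := by
  obtain ⟨DS₀, hDS₀⟩ := exists_dValid hG
  refine le_trans ?_ (le_csSup ?_ ⟨ES, hES, rfl⟩)
  · apply le_csInf
    · exact ⟨_, DS₀, hDS₀, rfl⟩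
    · rintro s ⟨DS, hDS, rfl⟩
      exact h DS hDS
  · refine ⟨Nat.card V, ?_⟩
    rintro r ⟨ES', -, rfl⟩
    refine le_trans (Nat.sInf_le ?_) (Set.ncard_le_card {x | ∃ n, x ∈ play ES' DS₀ v n})
    exact ⟨DS₀, hDS₀, rfl⟩

/-- `R` consists of vertices of eccentricity at least `j`, and the Director can stay in `R`
as long as the Explorer only makes calls `k` from `r` that guarantee, by the triangle
inequality, an answer of eccentricity at least `j`. -/
def IsLevelClosed (G : SimpleGraph V) (j : ℕ) (R : Finset V) : Prop :=
  ∀ r ∈ R, j ≤ ecc G r ∧ ∀ k, 1 ≤ k → k ≤ ecc G r → (j ≤ k ∨ k + j ≤ ecc G r) →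
    ∃ y ∈ R, G.dist r y = k

lemma IsLevelClosed.min_le_card {j : ℕ} {R : Finset V} (hR : IsLevelClosed G j R) {r : V}
    (hr : r ∈ R) : min (ecc G r + 1) (2 * (ecc G r - j + 1)) ≤ R.card := by
  obtain ⟨hj, hcl⟩ := hR r hr
  have himage : ∀ k ≤ ecc G r, (j ≤ k ∨ k + j ≤ ecc G r) → k ∈ R.image (G.dist r) := by
    intro k hk hjk
    rcases Nat.eq_zero_or_pos k with rfl | hpos
    · exact Finset.mem_image.2 ⟨r, hr, dist_self⟩
    · exact Finset.mem_image.2 (hcl k hpos hk hjk)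
  refine le_trans ?_ (Finset.card_image_le (s := R) (f := G.dist r))
  by_cases h : 2 * j ≤ ecc G r + 1
  · have hsub : Finset.range (ecc G r + 1) ⊆ R.image (G.dist r) := fun k hk => by
      rw [Finset.mem_range] at hk
      exact himage k (by omega) (by omega)
    have := Finset.card_le_card hsub
    rw [Finset.card_range] at this
    omega
  · have hsub : Finset.range (ecc G r - j + 1) ∪ Finset.Icc j (ecc G r) ⊆
        R.image (G.dist r) := fun k hk => by
      rw [Finset.mem_union, Finset.mem_range, Finset.mem_Icc] at hk
      exact himage k (by omega) (by omega)
    have hdisj : Disjoint (Finset.range (ecc G r - j + 1)) (Finset.Icc j (ecc G r)) :=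
      Finset.disjoint_left.2 fun k hk hk' => by
        rw [Finset.mem_range] at hk
        rw [Finset.mem_Icc] at hk'
        omega
    have := Finset.card_le_card hsub
    rw [Finset.card_union_of_disjoint hdisj, Finset.card_range, Nat.card_Icc] at this
    omega

/-- At every level `i` with `j ≤ i ≤ e`, the set `S` has at least
`min (e + 1) (2 * (e - i + 1))` vertices of eccentricity at least `i`. -/
def LevelsFilled (G : SimpleGraph V) (e j : ℕ) (S : Finset V) : Prop :=
  ∀ i, j ≤ i → i ≤ e → min (e + 1) (2 * (e - i + 1)) ≤ (S.filter fun u => i ≤ ecc G u).card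

lemma LevelsFilled.mono {e j : ℕ} {S S' : Finset V} (h : S ⊆ S')
    (hS : LevelsFilled G e j S) : LevelsFilled G e j S' := fun i h₁ h₂ =>
  (hS i h₁ h₂).trans (Finset.card_le_card (Finset.filter_subset_filter _ h))

variable [DecidableEq V] {T T' : V → Finset V → Prop}

/-- From token position `x` with set of visited vertices `S`, the Explorer can force, within
`n` moves, a position and visited set satisfying `T`. -/
def ForcesWithin (G : SimpleGraph V) (T : V → Finset V → Prop) :
    ℕ → V → Finset V → Prop
  | 0, x, S => T x S
  | n + 1, x, S => ForcesWithin G T n x S ∨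
      ∃ k, 1 ≤ k ∧ k ≤ ecc G x ∧ ∀ y, G.dist x y = k → ForcesWithin G T n y (insert y S)

/-- The Explorer can force `T` within some bounded number of moves. -/
def Forces (G : SimpleGraph V) (T : V → Finset V → Prop) (x : V) (S : Finset V) : Prop :=
  ∃ n, ForcesWithin G T n x S

lemma ForcesWithin.mono {n n' : ℕ} (h : n ≤ n') {x : V} {S : Finset V}
    (hf : ForcesWithin G T n x S) : ForcesWithin G T n' x S := by
  induction h with
  | refl => exact hf
  | step _ ih => exact Or.inl ih

lemma Forces.of_target {x : V} {S : Finset V} (h : T x S) : Forces G T x S := ⟨0, h⟩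

lemma Forces.of_call {x : V} {S : Finset V} {k : ℕ} (h₁ : 1 ≤ k) (h₂ : k ≤ ecc G x)
    (h : ∀ y, G.dist x y = k → Forces G T y (insert y S)) : Forces G T x S := by
  choose! n hn using h
  exact ⟨Finset.univ.sup n + 1, Or.inr ⟨k, h₁, h₂, fun y hy =>
    (hn y hy).mono (Finset.le_sup (Finset.mem_univ y))⟩⟩

lemma Forces.trans {x : V} {S : Finset V} (h : Forces G T x S)
    (hT : ∀ y S', T y S' → Forces G T' y S') : Forces G T' x S := by
  obtain ⟨n, hn⟩ := h
  induction n generalizing x S with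
  | zero => exact hT _ _ hn
  | succ n ih =>
    rcases hn with hn | ⟨k, h₁, h₂, h⟩
    · exact ih hn
    · exact .of_call h₁ h₂ fun y hy => ih (h y hy)

lemma forces_ssubset_or_exists_isLevelClosed (hG : G.Connected) {j : ℕ} {x : V}
    {S : Finset V} (hx : x ∈ S) (hj : j ≤ ecc G x) :
    Forces G (fun y S' => y ∈ S' ∧ j ≤ ecc G y ∧ S ⊂ S') x S ∨
      ∃ R ⊆ S, x ∈ R ∧ IsLevelClosed G j R := by
  classical
  set T : V → Finset V → Prop := fun y S' => y ∈ S' ∧ j ≤ ecc G y ∧ S ⊂ S'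
  refine or_iff_not_imp_left.2 fun hnot =>
    ⟨S.filter fun r => j ≤ ecc G r ∧ ¬ Forces G T r S, Finset.filter_subset _ _,
      by simp [hx, hj, hnot], fun r hr => ?_⟩
  obtain ⟨-, hjr, hnr⟩ := Finset.mem_filter.1 hr
  refine ⟨hjr, fun k h₁ h₂ hk => ?_⟩
  by_contra! hcon
  refine hnr (.of_call h₁ h₂ fun y hy => ?_)
  have hjy : j ≤ ecc G y := by
    have a := dist_le_ecc (G := G) y r
    have b := ecc_le_dist_add_ecc hG r y
    rw [dist_comm] at a
    omega
  by_cases hyS : y ∈ S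
  · rw [Finset.insert_eq_of_mem hyS]
    by_contra hny
    exact hcon y (Finset.mem_filter.2 ⟨hyS, hjy, hny⟩) hy
  · exact .of_target ⟨Finset.mem_insert_self _ _, hjy, Finset.ssubset_insert hyS⟩

lemma IsLevelClosed.levelsFilled {e j : ℕ} {R S : Finset V} (hR : IsLevelClosed G j R)
    (hne : R.Nonempty) (hRS : R ⊆ S) (hS : LevelsFilled G e (j + 1) S) :
    LevelsFilled G e j S := by
  intro i hji hie
  rcases hji.lt_or_eq with hlt | rfl
  · exact hS i hlt hie
  obtain ⟨r, hr, hmax⟩ := R.exists_max_image (ecc G) hne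
  have hcard := hR.min_le_card hr
  have hjr := (hR r hr).1
  have hsub : R ⊆ S.filter fun u => j ≤ ecc G u := fun u hu =>
    Finset.mem_filter.2 ⟨hRS hu, (hR u hu).1⟩
  by_cases he : e ≤ ecc G r
  · have := Finset.card_le_card hsub
    omega
  · have hfill := hS (ecc G r + 1) (by omega) (by omega)
    have hdisj : Disjoint R (S.filter fun u => ecc G r + 1 ≤ ecc G u) :=
      Finset.disjoint_left.2 fun u hu hu' => by
        have := hmax u hu
        have := (Finset.mem_filter.1 hu').2
        omega
    have hsub' : R ∪ (S.filter fun u => ecc G r + 1 ≤ ecc G u) ⊆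
        S.filter fun u => j ≤ ecc G u :=
      Finset.union_subset hsub (Finset.monotone_filter_right _ fun u _ hu => by omega)
    have := Finset.card_le_card hsub'
    rw [Finset.card_union_of_disjoint hdisj] at this
    omega

lemma forces_levelsFilled_of_succ (hG : G.Connected) {e j : ℕ} {x : V} {S : Finset V}
    (hx : x ∈ S) (hj : j ≤ ecc G x) (hS : LevelsFilled G e (j + 1) S) :
    Forces G (fun y S' => y ∈ S' ∧ j ≤ ecc G y ∧ LevelsFilled G e j S') x S := by
  induction hn : Fintype.card V - S.card using Nat.strong_induction_on generalizing x S with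
  | _ n ih =>
    rcases forces_ssubset_or_exists_isLevelClosed hG hx hj with h | ⟨R, hRS, hxR, hR⟩
    · refine h.trans fun y S' ⟨hy, hjy, hSS'⟩ =>
        ih _ ?_ hy hjy (hS.mono hSS'.subset) rfl
      have := Finset.card_lt_card hSS'
      have := Finset.card_le_univ S'
      omega
    · exact .of_target ⟨hx, hj, hR.levelsFilled ⟨x, hxR⟩ hRS hS⟩

/-- From a vertex of eccentricity at least `e`, the Explorer can force `e + 1` visited
vertices. -/
lemma forces_card (hG : G.Connected) {e : ℕ} {x : V} {S : Finset V} (hx : x ∈ S)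
    (he : e ≤ ecc G x) : Forces G (fun _ S' => e + 1 ≤ S'.card) x S := by
  have key : ∀ d ≤ e, Forces G
      (fun y S' => y ∈ S' ∧ e - d ≤ ecc G y ∧ LevelsFilled G e (e - d) S') x S := by
    intro d
    induction d with
    | zero =>
      exact fun _ => forces_levelsFilled_of_succ hG hx he fun i h₁ h₂ => by omega
    | succ d ih =>
      intro hd
      refine (ih (by omega)).trans fun y S' ⟨hy, hey, hS'⟩ =>
        forces_levelsFilled_of_succ hG hy (by omega) ?_
      rwa [show e - (d + 1) + 1 = e - d by omega]
  refine (key e le_rfl).trans fun y S' ⟨_, _, hS'⟩ => .of_target ?_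
  have h₁ := hS' 0 (by omega) (by omega)
  have h₂ := Finset.card_filter_le S' fun u => 0 ≤ ecc G u
  omega

/-- A valid strategy can be modified to follow a forced win of `T` as soon as there is one. -/
lemma exists_eValid_forcing {ES₀ : List V → ℕ} (hES₀ : EValid G ES₀) :
    ∃ ES : List V → ℕ, EValid G ES ∧ ∀ h u, h.head? = some u →
      (∀ n, ForcesWithin G T n u h.toFinset → T u h.toFinset ∨ (1 ≤ ES h ∧ ES h ≤ ecc G u ∧
        ∀ y, G.dist u y = ES h → ∃ n' < n, ForcesWithin G T n' y (insert y h.toFinset))) ∧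
      (¬ Forces G T u h.toFinset → ES h = ES₀ h) := by
  classical
  have hchoice : ∀ h : List V, ∃ k, ∀ u, h.head? = some u →
      (1 ≤ ecc G u → 1 ≤ k ∧ k ≤ ecc G u) ∧
      (∀ n, ForcesWithin G T n u h.toFinset → T u h.toFinset ∨ (1 ≤ k ∧ k ≤ ecc G u ∧
        ∀ y, G.dist u y = k → ∃ n' < n, ForcesWithin G T n' y (insert y h.toFinset))) ∧
      (¬ Forces G T u h.toFinset → k = ES₀ h) := by
    intro h
    rcases hu : h.head? with _ | u
    · exact ⟨0, by simp⟩
    simp only [Option.some.injEq, forall_eq']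
    by_cases hf : Forces G T u h.toFinset
    · have hspec := Nat.find_spec hf
      rcases hp : Nat.find hf with _ | p
      · rw [hp] at hspec
        exact ⟨ES₀ h, hES₀ h u hu, fun _ _ => Or.inl hspec, fun hnf => absurd hf hnf⟩
      · rw [hp] at hspec
        rcases hspec with hlow | ⟨k, h₁, h₂, hk⟩
        · exact absurd hlow (Nat.find_min hf (by omega))
        · refine ⟨k, fun _ => ⟨h₁, h₂⟩, fun n hn => Or.inr ⟨h₁, h₂, fun y hy =>
            ⟨p, ?_, hk y hy⟩⟩, fun hnf => absurd hf hnf⟩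
          have := Nat.find_min' hf hn
          omega
    · exact ⟨ES₀ h, hES₀ h u hu, fun n hn => absurd ⟨n, hn⟩ hf, fun _ => rfl⟩
  choose ES hES using hchoice
  exact ⟨ES, fun h u hu => (hES h u hu).1, fun h u hu => (hES h u hu).2⟩

/-- If the Explorer can force a visit to `A`, and can force `T` from every position in `A`,
then the Explorer can force `T`. -/
lemma exists_eValid_of_forces {v : V} {A : Set V}
    (hA : ∃ ES : List V → ℕ, EValid G ES ∧ ∀ DS : List V → ℕ → V, DValid G DS →
      ∃ n : ℕ, ∃ x ∈ play ES DS v n, x ∈ A)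
    (hT : ∀ a ∈ A, ∀ S : Finset V, a ∈ S → Forces G T a S) :
    ∃ ES : List V → ℕ, EValid G ES ∧ ∀ DS : List V → ℕ → V, DValid G DS →
      ∃ n u, T u (play ES DS v n).toFinset := by
  obtain ⟨ES₀, hES₀, hvisit⟩ := hA
  obtain ⟨ES, hES, hspec⟩ := exists_eValid_forcing (T := T) hES₀
  refine ⟨ES, hES, fun DS hDS => ?_⟩
  have hwin : ∀ N n u, (play ES DS v n).head? = some u →
      ForcesWithin G T N u (play ES DS v n).toFinset →
      ∃ n u, T u (play ES DS v n).toFinset := by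
    intro N
    induction N using Nat.strong_induction_on with
    | _ N ih =>
      intro n u hu hN
      rcases (hspec _ u hu).1 N hN with h | ⟨h₁, h₂, h⟩
      · exact ⟨n, u, h⟩
      · obtain ⟨N', hlt, hN'⟩ := h _ (hDS _ u hu _ h₁ h₂)
        exact ih N' hlt (n + 1) _ rfl (by rwa [play, List.toFinset_cons])
  by_contra hcon
  have hnot : ∀ n u, (play ES DS v n).head? = some u →
      ¬ Forces G T u (play ES DS v n).toFinset :=
    fun n u hu ⟨N, hN⟩ => hcon (hwin N n u hu hN)
  have hplay : ∀ n, play ES DS v n = play ES₀ DS v n := by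
    intro n
    induction n with
    | zero => rfl
    | succ n ih =>
      obtain ⟨u, hu⟩ := exists_head?_play ES DS v n
      have heq := (hspec _ u hu).2 (hnot n u hu)
      rw [play, play, heq, ih]
  obtain ⟨n, x, hx, hxA⟩ := hvisit DS hDS
  rw [← hplay] at hx
  obtain ⟨n', hn'⟩ := exists_head?_eq_of_mem_play hx
  exact hnot n' x hn' (hT x hxA _ (List.mem_toFinset.2 (List.mem_of_head? hn')))

end Forcing

/-- If the Explorer has a strategy from `v` forcing, against every Director
strategy, a visit to the set `A`, then `f_d(G,v) ≥ min_{a ∈ A} ecc(a) + 1`. -/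
theorem stmt_2 {V : Type*} [Fintype V] (G : SimpleGraph V) (hG : G.Connected)
    (v : V) (A : Set V)
    (hA : ∃ ES : List V → ℕ, EValid G ES ∧
      ∀ DS : List V → ℕ → V, DValid G DS →
        ∃ n : ℕ, ∃ x ∈ play ES DS v n, x ∈ A) :
    sInf {k : ℕ | ∃ a ∈ A, k = ecc G a} + 1 ≤ fd G v := by
  classical
  obtain ⟨ES, hES, h⟩ := exists_eValid_of_forces
    (T := fun _ S => sInf {k : ℕ | ∃ a ∈ A, k = ecc G a} + 1 ≤ S.card) hA
    fun a ha S haS => forces_card hG haS (Nat.sInf_le ⟨a, ha, rfl⟩)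
  refine le_fd hG ES hES fun DS hDS => ?_
  obtain ⟨n, -, hn⟩ := h DS hDS
  exact hn.trans (card_le_playScore ES DS v n)
end

section
/- Let n, m ≥ 2 be integers with n odd. Let p_0, p_1, …, p_{n+m−2} be a sequence of vertices of the grid graph L_{n,m} with p_0 = (0,0), p_{n+m−2} = (n−1, m−1), and each p_{t+1} obtained from p_t by increasing exactly one coordinate by 1 (a monotone corner-to-corner lattice path). Suppose the path contains every vertex of minimum eccentricity of L_{n,m}, namely the vertex ((n−1)/2, (m−1)/2) when m is odd, and both vertices ((n−1)/2, m/2 − 1) and ((n−1)/2, m/2) when m is even. Then the set {p_0, p_1, …, p_{n+m−2}} is a closed set of L_{n,m}. -/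
open SimpleGraph

variable {V : Type*}

namespace SimpleGraph

theorem dist_pathGraph_le_of_le {n : ℕ} {a b : Fin n} (h : a ≤ b) :
    (pathGraph n).dist a b ≤ (b : ℕ) - a := by
  obtain ⟨b, hb⟩ := b
  induction b with
  | zero =>
    have : a = ⟨0, hb⟩ := Fin.ext (Nat.le_zero.mp h)
    simp [this]
  | succ k ih =>
    rcases Nat.lt_or_ge k a with hk | hk
    · have : a = ⟨k + 1, hb⟩ := Fin.ext (le_antisymm h hk)
      simp [this]
    · have hadj : (pathGraph n).Adj ⟨k, by omega⟩ ⟨k + 1, hb⟩ := by simp [pathGraph_adj]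
      have htri := (pathGraph_preconnected n a ⟨k, by omega⟩).dist_triangle_left ⟨k + 1, hb⟩
      have := ih (by omega) hk
      rw [dist_eq_one_iff_adj.mpr hadj] at htri
      simp only at this ⊢
      omega

theorem Walk.natDist_le_length_of_pathGraph {n : ℕ} {a b : Fin n}
    (w : (pathGraph n).Walk a b) : Nat.dist a b ≤ w.length := by
  induction w with
  | nil => simp
  | cons h w ih =>
    rw [pathGraph_adj] at h
    simp only [Nat.dist, Walk.length_cons] at ih ⊢
    omega

theorem dist_pathGraph {n : ℕ} (a b : Fin n) : (pathGraph n).dist a b = Nat.dist a b := by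
  apply le_antisymm
  · rcases le_total a b with h | h
    · rw [Nat.dist_eq_sub_of_le h]
      exact dist_pathGraph_le_of_le h
    · rw [dist_comm, Nat.dist_eq_sub_of_le_right h]
      exact dist_pathGraph_le_of_le h
  · obtain ⟨w, hw⟩ := (pathGraph_preconnected n a b).exists_walk_length_eq_dist
    exact hw ▸ w.natDist_le_length_of_pathGraph

theorem Preconnected.dist_boxProd {α β : Type*} {G : SimpleGraph α} {H : SimpleGraph β}
    (hG : G.Preconnected) (hH : H.Preconnected) (x y : α × β) :
    (G □ H).dist x y = G.dist x.1 y.1 + H.dist x.2 y.2 := by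
  simp only [dist, edist_boxProd]
  exact ENat.toNat_add (edist_ne_top_iff_reachable.mpr (hG _ _))
    (edist_ne_top_iff_reachable.mpr (hH _ _))

end SimpleGraph

theorem dist_gridGraph {n m : ℕ} (x y : Fin n × Fin m) :
    (gridGraph n m).dist x y = Nat.dist x.1 y.1 + Nat.dist x.2 y.2 := by
  rw [gridGraph, (pathGraph_preconnected n).dist_boxProd (pathGraph_preconnected m),
    dist_pathGraph, dist_pathGraph]

/-- For `n, m ≥ 2` with `n` odd, any monotone corner-to-corner lattice path
in the grid `L_{n,m}` passing through every vertex of minimum eccentricity is a closed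
set of `L_{n,m}`. -/
theorem stmt_7 (n m : ℕ) (hn : 2 ≤ n) (hm : 2 ≤ m) (hodd : Odd n)
    (p : ℕ → Fin n × Fin m)
    (h0 : p 0 = (⟨0, by omega⟩, ⟨0, by omega⟩))
    (hend : p (n + m - 2) = (⟨n - 1, by omega⟩, ⟨m - 1, by omega⟩))
    (hstep : ∀ t < n + m - 2,
      (((p (t + 1)).1 : ℕ) = ((p t).1 : ℕ) + 1 ∧ (p (t + 1)).2 = (p t).2) ∨
      ((p (t + 1)).1 = (p t).1 ∧ ((p (t + 1)).2 : ℕ) = ((p t).2 : ℕ) + 1))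
    (hcenterOdd : Odd m → ∃ t ≤ n + m - 2,
      p t = (⟨(n - 1) / 2, by omega⟩, ⟨(m - 1) / 2, by omega⟩))
    (hcenterEven : Even m →
      (∃ t ≤ n + m - 2, p t = (⟨(n - 1) / 2, by omega⟩, ⟨m / 2 - 1, by omega⟩)) ∧
      (∃ t ≤ n + m - 2, p t = (⟨(n - 1) / 2, by omega⟩, ⟨m / 2, by omega⟩))) :
    IsClosedSet (gridGraph n m) {x : Fin n × Fin m | ∃ t ≤ n + m - 2, p t = x} := by
  have hsum : ∀ t ≤ n + m - 2, ((p t).1 : ℕ) + (p t).2 = t := by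
    intro t ht
    induction t with
    | zero => simp [h0]
    | succ k ih =>
      have := ih (by omega)
      rcases hstep k (by omega) with ⟨h₁, h₂⟩ | ⟨h₁, h₂⟩
      · rw [h₁, h₂]; omega
      · rw [h₁, h₂]; omega
  have hmono : ∀ s t, s ≤ t → t ≤ n + m - 2 → (p s).1 ≤ (p t).1 ∧ (p s).2 ≤ (p t).2 := by
    intro s t hst
    induction t, hst using Nat.le_induction with
    | base => simp
    | succ k _ ih =>
      intro hk
      have := ih (by omega)
      have := hstep k (by omega)
      simp only [Fin.le_def, Fin.ext_iff] at *
      omega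
  have hdist : ∀ s t, s ≤ t → t ≤ n + m - 2 → (gridGraph n m).dist (p s) (p t) = t - s := by
    intro s t hst ht
    have h := hmono s t hst ht
    rw [dist_gridGraph, Nat.dist_eq_sub_of_le h.1, Nat.dist_eq_sub_of_le h.2]
    have := hsum s (by omega)
    have := hsum t ht
    simp only [Fin.le_def] at h
    omega
  have hhalf : ∀ t ≤ n + m - 2,
      (2 * ((p t).1 : ℕ) ≤ n - 1 ∧ 2 * ((p t).2 : ℕ) ≤ m - 1) ∨
      (n - 1 ≤ 2 * ((p t).1 : ℕ) ∧ m - 1 ≤ 2 * ((p t).2 : ℕ)) := by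
    intro t ht
    have hn₂ := Nat.odd_iff.mp hodd
    rcases Nat.even_or_odd m with hme | hmo
    · obtain ⟨⟨s, hs, hps⟩, r, hr, hpr⟩ := hcenterEven hme
      have hss := hsum s hs
      have hrr := hsum r hr
      simp only [hps, hpr] at hss hrr
      have := Nat.even_iff.mp hme
      rcases le_or_gt t s with h | h
      · have := hmono t s h hs
        simp only [hps, Fin.le_def] at this
        omega
      · have := hmono r t (by omega) ht
        simp only [hpr, Fin.le_def] at this
        omega
    · obtain ⟨s, hs, hps⟩ := hcenterOdd hmo
      have := Nat.odd_iff.mp hmo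
      rcases le_total t s with h | h
      · have := hmono t s h hs
        simp only [hps, Fin.le_def] at this
        omega
      · have := hmono s t h ht
        simp only [hps, Fin.le_def] at this
        omega
  refine ⟨⟨p 0, 0, Nat.zero_le _, rfl⟩, ?_⟩
  rintro _ ⟨t, ht, rfl⟩ v
  have hv : (gridGraph n m).dist (p t) v ≤ t ∨
      t + (gridGraph n m).dist (p t) v ≤ n + m - 2 := by
    have := hsum t ht
    have := hhalf t ht
    have := v.1.isLt
    have := v.2.isLt
    rw [dist_gridGraph]
    simp only [Nat.dist]
    omega
  rcases hv with hv | hv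
  · refine ⟨_, ⟨t - (gridGraph n m).dist (p t) v, by omega, rfl⟩, ?_⟩
    rw [dist_comm (v := p (t - _)), hdist _ _ (by omega) ht]
    omega
  · refine ⟨_, ⟨_, hv, rfl⟩, ?_⟩
    rw [hdist _ _ (by omega) hv]
    omega
end

section
/- Let n ≥ 4 be an even integer. Then the set B = {(i,0) : 0 ≤ i ≤ n−1} ∪ {(i,n−1) : 0 ≤ i ≤ n−1} ∪ {(n−2, j) : 2 ≤ j ≤ n−3} is a closed set of the grid graph L_{n,n}, and it has cardinality 3n − 4. -/
open SimpleGraph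

variable {V : Type*}

theorem Nat.exists_lt_sub_add_sub_eq {n a k : ℕ} (ha : a < n) (hk : k ≤ a ∨ a + k < n) :
    ∃ x < n, (a - x) + (x - a) = k := by
  rcases hk with hk | hk
  · exact ⟨a - k, by omega, by omega⟩
  · exact ⟨a + k, hk, by omega⟩

theorem SimpleGraph.Walk.pathGraph_sub_add_sub_le_length {n : ℕ} {u v : Fin n}
    (p : (pathGraph n).Walk u v) :
    ((u : ℕ) - v) + ((v : ℕ) - u) ≤ p.length := by
  induction p with
  | nil => simp
  | cons h p ih =>
    rw [pathGraph_adj] at h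
    rw [Walk.length_cons]
    omega

theorem SimpleGraph.pathGraph_dist_le_of_add_eq {n k : ℕ} {u v : Fin n} (h : (u : ℕ) + k = v) :
    (pathGraph n).dist u v ≤ k := by
  induction k generalizing v with
  | zero =>
    obtain rfl : u = v := Fin.ext h
    simp
  | succ k ih =>
    have hw : (pathGraph n).Adj ⟨u + k, by omega⟩ v := pathGraph_adj.2 (Or.inl (by simp; omega))
    have h₁ := ih (v := ⟨u + k, by omega⟩) rfl
    have h₂ := (pathGraph_preconnected n u ⟨u + k, by omega⟩).dist_triangle_left v
    have h₃ := dist_eq_one_iff_adj.2 hw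
    omega

theorem SimpleGraph.pathGraph_dist {n : ℕ} (u v : Fin n) :
    (pathGraph n).dist u v = ((u : ℕ) - v) + ((v : ℕ) - u) := by
  apply le_antisymm
  · rcases le_total (u : ℕ) v with h | h
    · exact (pathGraph_dist_le_of_add_eq (k := v - u) (by omega)).trans (by omega)
    · rw [dist_comm]
      exact (pathGraph_dist_le_of_add_eq (k := u - v) (by omega)).trans (by omega)
  · obtain ⟨p, hp⟩ := (pathGraph_preconnected n u v).exists_walk_length_eq_dist
    exact hp ▸ p.pathGraph_sub_add_sub_le_length

theorem SimpleGraph.Preconnected.dist_boxProd_s8 {α β : Type*} {G : SimpleGraph α}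
    {H : SimpleGraph β} (hG : G.Preconnected) (hH : H.Preconnected) (x y : α × β) :
    (G □ H).dist x y = G.dist x.1 y.1 + H.dist x.2 y.2 := by
  have h := edist_boxProd (G := G) (H := H) x y
  rw [← (hG.boxProd hH x y).coe_dist_eq_edist, ← (hG x.1 y.1).coe_dist_eq_edist,
    ← (hH x.2 y.2).coe_dist_eq_edist] at h
  exact_mod_cast h

theorem gridGraph_dist {n m : ℕ} (p q : Fin n × Fin m) :
    (gridGraph n m).dist p q =
      ((p.1 : ℕ) - q.1) + ((q.1 : ℕ) - p.1) + (((p.2 : ℕ) - q.2) + ((q.2 : ℕ) - p.2)) := by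
  rw [gridGraph, (pathGraph_preconnected n).dist_boxProd_s8 (pathGraph_preconnected m),
    pathGraph_dist, pathGraph_dist]

/-- Membership in the set consisting of the rows `0` and `n - 1` and of the inner part of
column `n - 2`, in terms of coordinates. -/
def InRowsOrColumn (n i j : ℕ) : Prop :=
  j = 0 ∨ j = n - 1 ∨ (i = n - 2 ∧ 2 ≤ j ∧ j ≤ n - 3)

theorem InRowsOrColumn.exists_of_lower {n a b c d : ℕ} (hn : 4 ≤ n) (he : Even n) (ha : a < n)
    (hc : c < n) (hd : d < n) (hab : InRowsOrColumn n a b) (hb : 2 * b < n) :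
    ∃ x < n, ∃ y < n, InRowsOrColumn n x y ∧
      (a - c) + (c - a) + ((b - d) + (d - b)) = (a - x) + (x - a) + ((b - y) + (y - b)) := by
  obtain ⟨m, rfl⟩ := he
  obtain ⟨D, hD⟩ : ∃ D, D = (a - c) + (c - a) + ((b - d) + (d - b)) := ⟨_, rfl⟩
  rw [← hD]
  unfold InRowsOrColumn at *
  obtain rfl | ⟨rfl, -, -⟩ : b = 0 ∨ (a = m + m - 2 ∧ 2 ≤ b ∧ b ≤ m + m - 3) := by omega
  · by_cases h₁ : D ≤ a ∨ a + D < m + m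
    · obtain ⟨x, hx, hxD⟩ := Nat.exists_lt_sub_add_sub_eq ha h₁
      exact ⟨x, hx, 0, by omega, by omega, by omega⟩
    by_cases h₂ : m + m - 1 ≤ D
    · obtain ⟨x, hx, hxD⟩ := Nat.exists_lt_sub_add_sub_eq (k := D - (m + m - 1)) ha (by omega)
      exact ⟨x, hx, m + m - 1, by omega, by omega, by omega⟩
    · exact ⟨m + m - 2, by omega, D - (m + m - 2 - a), by omega, by omega, by omega⟩
  · by_cases h₁ : D < b
    · exact ⟨m + m - 2, by omega, b + D, by omega, by omega, by omega⟩
    by_cases h₂ : D ≤ b + (m + m - 2)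
    · exact ⟨m + m - 2 - (D - b), by omega, 0, by omega, by omega, by omega⟩
    · exact ⟨m + m - 2 - (D - (m + m - 1 - b)), by omega, m + m - 1, by omega, by omega, by omega⟩

theorem InRowsOrColumn.reflect {n a b : ℕ} (hb : b < n) (h : InRowsOrColumn n a b) :
    InRowsOrColumn n a (n - 1 - b) := by
  unfold InRowsOrColumn at *
  omega

theorem InRowsOrColumn.exists_dist_eq {n a b c d : ℕ} (hn : 4 ≤ n) (he : Even n) (ha : a < n)
    (hb : b < n) (hc : c < n) (hd : d < n) (hab : InRowsOrColumn n a b) :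
    ∃ x < n, ∃ y < n, InRowsOrColumn n x y ∧
      (a - c) + (c - a) + ((b - d) + (d - b)) = (a - x) + (x - a) + ((b - y) + (y - b)) := by
  by_cases h : 2 * b < n
  · exact hab.exists_of_lower hn he ha hc hd h
  · obtain ⟨x, hx, y, hy, hxy, hD⟩ := (hab.reflect hb).exists_of_lower hn he ha hc
      (d := n - 1 - d) (by omega) (by omega)
    exact ⟨x, hx, n - 1 - y, by omega, hxy.reflect hy, by omega⟩

theorem ncard_rows_union_column {n : ℕ} (hn : 4 ≤ n) :
    Set.ncard {p : Fin n × Fin n | InRowsOrColumn n p.1 p.2} = 3 * n - 4 := by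
  let first : Fin n := ⟨0, by omega⟩
  let last : Fin n := ⟨n - 1, by omega⟩
  let col : Finset (Fin n × Fin n) :=
    {⟨n - 2, by omega⟩} ×ˢ Finset.Icc ⟨2, by omega⟩ ⟨n - 3, by omega⟩
  have hset : {p : Fin n × Fin n | InRowsOrColumn n p.1 p.2} =
      ↑((Finset.univ ×ˢ {first, last}) ∪ col) := by
    ext ⟨i, j⟩
    simp only [InRowsOrColumn, first, last, col, Set.mem_ofPred_eq, Finset.mem_coe,
      Finset.mem_union, Finset.mem_product, Finset.mem_univ, Finset.mem_insert,
      Finset.mem_singleton, Finset.mem_Icc, Fin.ext_iff, Fin.le_def, true_and, or_assoc]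
  have hdisj : Disjoint (Finset.univ ×ˢ {first, last}) col := by
    rw [Finset.disjoint_left]
    rintro ⟨i, j⟩
    simp only [first, last, col, Finset.mem_product, Finset.mem_univ, Finset.mem_insert,
      Finset.mem_singleton, Finset.mem_Icc, Fin.ext_iff, Fin.le_def, true_and]
    omega
  have hne : first ≠ last := by
    simp only [first, last, ne_eq, Fin.ext_iff]
    omega
  rw [hset, Set.ncard_coe_finset, Finset.card_union_of_disjoint hdisj, Finset.card_product,
    Finset.card_pair hne, Finset.card_product, Fin.card_Icc]
  simp only [Finset.card_univ, Fintype.card_fin, Finset.card_singleton]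
  omega

/-- For even `n ≥ 4`, the set
`B = {(i,0)} ∪ {(i,n-1)} ∪ {(n-2,j) : 2 ≤ j ≤ n-3}` is a closed set of the grid
`L_{n,n}` of cardinality `3n - 4`. -/
theorem stmt_8 (n : ℕ) (hn : 4 ≤ n) (he : Even n) :
    IsClosedSet (gridGraph n n)
      {p : Fin n × Fin n | (p.2 : ℕ) = 0 ∨ (p.2 : ℕ) = n - 1 ∨
        ((p.1 : ℕ) = n - 2 ∧ 2 ≤ (p.2 : ℕ) ∧ (p.2 : ℕ) ≤ n - 3)} ∧
    Set.ncard {p : Fin n × Fin n | (p.2 : ℕ) = 0 ∨ (p.2 : ℕ) = n - 1 ∨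
        ((p.1 : ℕ) = n - 2 ∧ 2 ≤ (p.2 : ℕ) ∧ (p.2 : ℕ) ≤ n - 3)} = 3 * n - 4 := by
  refine ⟨⟨⟨(⟨0, by omega⟩, ⟨0, by omega⟩), Or.inl rfl⟩, fun u hu v => ?_⟩,
    ncard_rows_union_column hn⟩
  obtain ⟨x, hx, y, hy, hxy, hD⟩ :=
    InRowsOrColumn.exists_dist_eq hn he u.1.2 u.2.2 v.1.2 v.2.2 hu
  refine ⟨(⟨x, hx⟩, ⟨y, hy⟩), hxy, ?_⟩
  rw [gridGraph_dist, gridGraph_dist]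
  exact hD
end
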